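/- Let θ₁, θ₂ be real numbers such that 1, θ₁, θ₂ are linearly independent over ℤ, let L(x) = x₀ + x₁θ₁ + x₂θ₂, let P and F be linear forms on ℝ³ such that L, P, F are linearly independent, and let (x_ν) be the sequence of minimal points of L with X_ν = |x_ν|, L_ν = L(x_ν), P_ν = P(x_ν). Let α > 2 and suppose L_j ≤ X_{j+1}^{−α} for all sufficiently large j. Let r > 0 satisfy r < α² − α + 1. Then there exist a constant c > 0 and an index N such that: for every ν ≥ N for which x_{ν−1}, x_ν, x_{ν+1} are linearly independent and |P_ν| ≤ L_ν·X_ν^r, one has |P_{ν+1}| ≥ c·X_ν^{α−1}. -/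

import Mathlib

/-- Euclidean norm of an integer vector in `ℤ³`. -/
noncomputable def enormZ (v : Fin 3 → ℤ) : ℝ :=
  Real.sqrt ((v 0 : ℝ) ^ 2 + (v 1 : ℝ) ^ 2 + (v 2 : ℝ) ^ 2)

/-- The real vector associated to an integer vector. -/
def toR (v : Fin 3 → ℤ) : Fin 3 → ℝ := fun i => (v i : ℝ)

/-- The rational vector associated to an integer vector. -/
def toQ (v : Fin 3 → ℤ) : Fin 3 → ℚ := fun i => (v i : ℚ)

/-- The linear form `L(x) = x₀ + x₁ θ₁ + x₂ θ₂` on `ℝ³`. -/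
noncomputable def Lform (θ₁ θ₂ : ℝ) : (Fin 3 → ℝ) →ₗ[ℝ] ℝ :=
  LinearMap.proj 0 + θ₁ • LinearMap.proj 1 + θ₂ • LinearMap.proj 2

open Filter Topology

theorem one_le_enormZ {v : Fin 3 → ℤ} (hv : v ≠ 0) : 1 ≤ enormZ v := by
  unfold enormZ
  rw [Real.one_le_sqrt]
  have h : 0 < v 0 ^ 2 + v 1 ^ 2 + v 2 ^ 2 := by
    by_contra! h
    apply hv
    have h0 := sq_nonneg (v 0)
    have h1 := sq_nonneg (v 1)
    have h2 := sq_nonneg (v 2)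
    have hsq : ∀ i, v i ^ 2 = 0 := by
      simp only [Fin.forall_fin_succ, Fin.succ_zero_eq_one, Fin.succ_one_eq_two, IsEmpty.forall_iff,
        and_true]
      exact ⟨by linarith, by linarith, by linarith⟩
    exact funext fun i => (pow_eq_zero_iff two_ne_zero).mp (hsq i)
  exact_mod_cast h

theorem abs_apply_le_enormZ (v : Fin 3 → ℤ) (i : Fin 3) : |(v i : ℝ)| ≤ enormZ v := by
  apply Real.abs_le_sqrt
  have h0 := sq_nonneg (v 0 : ℝ)
  have h1 := sq_nonneg (v 1 : ℝ)
  have h2 := sq_nonneg (v 2 : ℝ)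
  fin_cases i <;> simp <;> linarith

theorem linearMap_apply_eq_sum (G : (Fin 3 → ℝ) →ₗ[ℝ] ℝ) (y : Fin 3 → ℝ) :
    G y = ∑ i, G (Pi.single i 1) * y i := by
  conv_lhs => rw [pi_eq_sum_univ' y]
  simp [mul_comm]

theorem exists_abs_le_mul_enormZ (G : (Fin 3 → ℝ) →ₗ[ℝ] ℝ) :
    ∃ K : ℝ, 0 ≤ K ∧ ∀ v : Fin 3 → ℤ, |G (toR v)| ≤ K * enormZ v := by
  refine ⟨∑ i, |G (Pi.single i 1)|, by positivity, fun v => ?_⟩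
  rw [linearMap_apply_eq_sum, Finset.sum_mul]
  refine (Finset.abs_sum_le_sum_abs _ _).trans (Finset.sum_le_sum fun i _ => ?_)
  rw [abs_mul]
  exact mul_le_mul_of_nonneg_left (abs_apply_le_enormZ v i) (abs_nonneg _)

theorem tendsto_enormZ_atTop {x : ℕ → Fin 3 → ℤ} (hx : ∀ n, enormZ (x n) < enormZ (x (n + 1))) :
    Tendsto (fun n => enormZ (x n)) atTop atTop := by
  have h (n : ℕ) : (n : ℤ) ≤ x n 0 ^ 2 + x n 1 ^ 2 + x n 2 ^ 2 := by
    induction n with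
    | zero => positivity
    | succ n ih =>
      have h1 := (Real.sqrt_lt_sqrt_iff (by positivity)).mp (hx n)
      have h2 : x n 0 ^ 2 + x n 1 ^ 2 + x n 2 ^ 2
          < x (n + 1) 0 ^ 2 + x (n + 1) 1 ^ 2 + x (n + 1) 2 ^ 2 := by exact_mod_cast h1
      push_cast
      omega
  refine tendsto_atTop_mono (f := fun n : ℕ => Real.sqrt n) (fun n => Real.sqrt_le_sqrt ?_)
    (Real.tendsto_sqrt_atTop.comp tendsto_natCast_atTop_atTop)
  exact_mod_cast h n

theorem one_le_abs_det_of_linearIndependent {v : Fin 3 → Fin 3 → ℤ}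
    (h : LinearIndependent ℚ fun i => toQ (v i)) :
    1 ≤ |(Matrix.of fun i => toR (v i)).det| := by
  have hQ : (Matrix.of fun i => toQ (v i)).det = ((Matrix.of v).det : ℚ) :=
    ((Int.castRingHom ℚ).map_det (Matrix.of v)).symm
  have hR : (Matrix.of fun i => toR (v i)).det = ((Matrix.of v).det : ℝ) :=
    ((Int.castRingHom ℝ).map_det (Matrix.of v)).symm
  have hu : IsUnit (Matrix.of fun i => toQ (v i)) :=
    Matrix.linearIndependent_rows_iff_isUnit.mp h
  have hne : (Matrix.of v).det ≠ 0 := by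
    intro h0
    rw [Matrix.isUnit_iff_isUnit_det, hQ, h0] at hu
    simp at hu
  rw [hR]
  exact_mod_cast Int.one_le_abs hne

theorem det_coeff_ne_zero {G : Fin 3 → (Fin 3 → ℝ) →ₗ[ℝ] ℝ} (h : LinearIndependent ℝ G) :
    (Matrix.of fun i j => G i (Pi.single j 1)).det ≠ 0 := by
  let E : ((Fin 3 → ℝ) →ₗ[ℝ] ℝ) →ₗ[ℝ] (Fin 3 → ℝ) :=
    LinearMap.pi fun j => LinearMap.applyₗ (Pi.single j 1)
  have hE : LinearMap.ker E = ⊥ := by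
    refine LinearMap.ker_eq_bot'.mpr fun g hg => LinearMap.ext fun y => ?_
    rw [linearMap_apply_eq_sum]
    have hg' (j : Fin 3) : g (Pi.single j 1) = 0 := congrFun hg j
    simp [hg']
  have hu : IsUnit (Matrix.of fun i j => G i (Pi.single j 1)) :=
    Matrix.linearIndependent_rows_iff_isUnit.mp (h.map' E hE)
  exact ((Matrix.isUnit_iff_isUnit_det _).mp hu).ne_zero

/-- The values of three independent linear forms at three rationally independent integer points
have a determinant bounded away from zero. -/
theorem exists_le_abs_det_apply {G : Fin 3 → (Fin 3 → ℝ) →ₗ[ℝ] ℝ} (h : LinearIndependent ℝ G) :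
    ∃ δ > (0 : ℝ), ∀ v : Fin 3 → Fin 3 → ℤ, LinearIndependent ℚ (fun i => toQ (v i)) →
      δ ≤ |(Matrix.of fun i j => G i (toR (v j))).det| := by
  refine ⟨_, abs_pos.mpr (det_coeff_ne_zero h), fun v hv => ?_⟩
  have hmul : (Matrix.of fun i j => G i (toR (v j))) =
      (Matrix.of fun i j => G i (Pi.single j 1)) * (Matrix.of fun i => toR (v i)).transpose := by
    ext i j
    simp only [Matrix.mul_apply, Matrix.of_apply, Matrix.transpose_apply]
    exact linearMap_apply_eq_sum _ _
  rw [hmul, Matrix.det_mul, Matrix.det_transpose, abs_mul]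
  exact le_mul_of_one_le_right (abs_nonneg _) (one_le_abs_det_of_linearIndependent hv)

/-- Bound for a `3 × 3` determinant with rows `(la, lb, lc)`, `(pa, pb, pc)`, `(fa, fb, fc)` whose
last two rows grow at most like `a < b < d`. -/
theorem abs_det_expansion_le {K a b d la lb lc pa pb pc fa fb fc : ℝ} (hK : 0 ≤ K) (ha : 0 ≤ a)
    (hab : a ≤ b) (hbd : b ≤ d) (hlc : 0 ≤ lc) (hcb : lc ≤ lb) (hba : lb ≤ la)
    (hpa : |pa| ≤ K * a) (hpb : |pb| ≤ K * b)
    (hfa : |fa| ≤ K * a) (hfb : |fb| ≤ K * b) (hfc : |fc| ≤ K * d) :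
    |la * (pb * fc - pc * fb) - lb * (pa * fc - pc * fa) + lc * (pa * fb - pb * fa)| ≤
      K * (la * |pb| * d) + 2 * K * (la * b * |pc|) + 3 * K ^ 2 * (d ^ 2 * lb) := by
  have hb : 0 ≤ b := ha.trans hab
  have hd : 0 ≤ d := hb.trans hbd
  have hlb : 0 ≤ lb := hlc.trans hcb
  have hla : 0 ≤ la := hlb.trans hba
  have e1 : |la * pb * fc| ≤ la * |pb| * (K * d) := by
    rw [abs_mul, abs_mul, abs_of_nonneg hla]; gcongr
  have e2 : |la * pc * fb| ≤ la * |pc| * (K * b) := by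
    rw [abs_mul, abs_mul, abs_of_nonneg hla]; gcongr
  have e3 : |lb * pa * fc| ≤ lb * (K * d) * (K * d) := by
    rw [abs_mul, abs_mul, abs_of_nonneg hlb]
    gcongr
    exact hpa.trans (by gcongr; exact hab.trans hbd)
  have e4 : |lb * pc * fa| ≤ la * |pc| * (K * b) := by
    rw [abs_mul, abs_mul, abs_of_nonneg hlb]
    gcongr
    exact hfa.trans (by gcongr)
  have e5 : |lc * pa * fb| ≤ lb * (K * d) * (K * d) := by
    rw [abs_mul, abs_mul, abs_of_nonneg hlc]
    gcongr
    · exact hpa.trans (by gcongr; exact hab.trans hbd)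
    · exact hfb.trans (by gcongr)
  have e6 : |lc * pb * fa| ≤ lb * (K * d) * (K * d) := by
    rw [abs_mul, abs_mul, abs_of_nonneg hlc]
    gcongr
    · exact hpb.trans (by gcongr)
    · exact hfa.trans (by gcongr; exact hab.trans hbd)
  rw [abs_le] at *
  constructor <;> linarith [e1.1, e1.2, e2.1, e2.2, e3.1, e3.2, e4.1, e4.2, e5.1, e5.2, e6.1, e6.2]

/-- Deduction of the lower bound for `q = |pc|` from the determinant estimate, once `b` is large. -/
theorem lower_bound_of_det_estimate {α r δ K η b d la lb p q : ℝ} (hα : 2 < α) (hδ : 0 < δ)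
    (hK : 0 < K) (hη : η = δ / (6 * K ^ 2)) (hb : 1 ≤ b) (hbd : b ≤ d)
    (hla0 : 0 < la) (hla : la ≤ b ^ (-α)) (hlb : lb ≤ d ^ (-α))
    (hp0 : 0 ≤ p) (hpb : p ≤ K * b) (hpr : p ≤ lb * b ^ r) (hq0 : 0 ≤ q) (hqd : q ≤ K * d)
    (hdet : δ ≤ K * (la * p * d) + 2 * K * (la * b * q) + 3 * K ^ 2 * (d ^ 2 * lb))
    (hsmall : 3 * K ^ 2 * b ^ (2 - α) ≤ δ / 4)
    (hsmall' : K * η ^ (1 - α) * b ^ (r - (α ^ 2 - α + 1)) ≤ δ / 4) :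
    δ / (4 * K) * b ^ (α - 1) ≤ q := by
  have hb0 : 0 < b := by linarith
  have hd0 : 0 < d := by linarith
  have hη0 : 0 < η := by rw [hη]; positivity
  have h1 : d ^ 2 * lb ≤ b ^ (2 - α) := by
    calc d ^ 2 * lb ≤ d ^ 2 * d ^ (-α) := by gcongr
      _ = d ^ (2 - α) := by rw [← Real.rpow_natCast, ← Real.rpow_add hd0]; congr 1
      _ ≤ b ^ (2 - α) := Real.rpow_le_rpow_of_nonpos hb0 hbd (by linarith)
  have h1' : 3 * K ^ 2 * (d ^ 2 * lb) ≤ δ / 4 := le_trans (by gcongr) hsmall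
  have hlab : la * b ≤ b ^ (1 - α) := by
    calc la * b ≤ b ^ (-α) * b := by gcongr
      _ = b ^ (1 - α) := by
        rw [show 1 - α = -α + 1 by ring, Real.rpow_add hb0, Real.rpow_one]
  have hinv : b ^ (1 - α) * b ^ (α - 1) = 1 := by
    rw [← Real.rpow_add hb0]; simp
  have hpos : 0 < b ^ (α - 1) := Real.rpow_pos_of_pos hb0 _
  have hgap : η * b ^ (α - 1) ≤ d := by
    have h2 : K * (la * p * d) ≤ K ^ 2 * (b ^ (1 - α) * d) := by
      calc K * (la * p * d) ≤ K * (la * (K * b) * d) := by gcongr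
        _ = K ^ 2 * (la * b * d) := by ring
        _ ≤ _ := by gcongr
    have h3 : 2 * K * (la * b * q) ≤ 2 * K ^ 2 * (b ^ (1 - α) * d) := by
      calc 2 * K * (la * b * q) ≤ 2 * K * (b ^ (1 - α) * (K * d)) := by gcongr
        _ = _ := by ring
    have h4 : δ / 2 ≤ 3 * K ^ 2 * (b ^ (1 - α) * d) := by linarith
    have h5 : η ≤ b ^ (1 - α) * d := by
      rw [hη, div_le_iff₀ (by positivity)]; linarith
    calc η * b ^ (α - 1) ≤ (b ^ (1 - α) * d) * b ^ (α - 1) := by gcongr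
      _ = (b ^ (1 - α) * b ^ (α - 1)) * d := by ring
      _ = d := by rw [hinv, one_mul]
  have hmain : K * (la * p * d) ≤ δ / 4 := by
    refine le_trans ?_ hsmall'
    have hdα : d ^ (-α) * d = d ^ (1 - α) := by
      rw [show 1 - α = -α + 1 by ring, Real.rpow_add hd0, Real.rpow_one]
    calc K * (la * p * d) ≤ K * (b ^ (-α) * (d ^ (-α) * b ^ r) * d) := by
          gcongr
          exact hpr.trans (by gcongr)
      _ = K * (b ^ (-α) * b ^ r * (d ^ (-α) * d)) := by ring
      _ ≤ K * (b ^ (-α) * b ^ r * (η * b ^ (α - 1)) ^ (1 - α)) := by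
          rw [hdα]
          have h6 := Real.rpow_le_rpow_of_nonpos (by positivity) hgap
            (show 1 - α ≤ 0 by linarith)
          gcongr
      _ = K * η ^ (1 - α) * (b ^ (-α) * b ^ r * b ^ ((α - 1) * (1 - α))) := by
          rw [Real.mul_rpow hη0.le hpos.le, ← Real.rpow_mul hb0.le]; ring
      _ = _ := by
          rw [← Real.rpow_add hb0, ← Real.rpow_add hb0]; congr 2; ring
  have h6 : δ / 2 ≤ 2 * K * (b ^ (1 - α) * q) := by
    have : 2 * K * (la * b * q) ≤ 2 * K * (b ^ (1 - α) * q) := by gcongr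
    linarith
  have h7 : δ / (4 * K) ≤ b ^ (1 - α) * q := by
    rw [div_le_iff₀ (by positivity)]; linarith
  calc δ / (4 * K) * b ^ (α - 1) ≤ (b ^ (1 - α) * q) * b ^ (α - 1) := by gcongr
    _ = (b ^ (1 - α) * b ^ (α - 1)) * q := by ring
    _ = q := by rw [hinv, one_mul]

/-- Lemma 4 of the paper: with `α > 2` admissible eventually (`L_j ≤ X_{j+1}^{−α}` for large `j`)
and `0 < r < α² − α + 1`, for all sufficiently large `ν` with `x_{ν−1}, x_ν, x_{ν+1}` linearly
independent and `|P_ν| ≤ L_ν·X_ν^r`, one has `|P_{ν+1}| ≥ c·X_ν^{α−1}`. -/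
theorem lemma_four (θ₁ θ₂ : ℝ)
    (hind : ∀ a b c : ℤ, (a : ℝ) + (b : ℝ) * θ₁ + (c : ℝ) * θ₂ = 0 → a = 0 ∧ b = 0 ∧ c = 0)
    (P F : (Fin 3 → ℝ) →ₗ[ℝ] ℝ)
    (hLPF : LinearIndependent ℝ ![Lform θ₁ θ₂, P, F])
    -- `x` is the sequence of minimal points (best approximations) of `L`:
    (x : ℕ → Fin 3 → ℤ)
    (hx0 : ∀ ν, x ν ≠ 0)
    (hLpos : ∀ ν, 0 < Lform θ₁ θ₂ (toR (x ν)))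
    (hXlt : ∀ ν, enormZ (x ν) < enormZ (x (ν + 1)))
    (hLlt : ∀ ν, Lform θ₁ θ₂ (toR (x (ν + 1))) < Lform θ₁ θ₂ (toR (x ν)))
    (hbest : ∀ ν, ∀ y : Fin 3 → ℤ, y ≠ 0 → enormZ y < enormZ (x (ν + 1)) →
      Lform θ₁ θ₂ (toR (x ν)) ≤ |Lform θ₁ θ₂ (toR y)|)
    (α : ℝ) (hα : 2 < α)
    (hsii : ∃ J₀ : ℕ, ∀ j, J₀ ≤ j → Lform θ₁ θ₂ (toR (x j)) ≤ enormZ (x (j + 1)) ^ (-α))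
    (r : ℝ) (hr0 : 0 < r) (hr : r < α ^ 2 - α + 1) :
    ∃ c > (0 : ℝ), ∃ N : ℕ, ∀ ν, N ≤ ν →
      LinearIndependent ℚ ![toQ (x (ν - 1)), toQ (x ν), toQ (x (ν + 1))] →
      |P (toR (x ν))| ≤ Lform θ₁ θ₂ (toR (x ν)) * enormZ (x ν) ^ r →
      c * enormZ (x ν) ^ (α - 1) ≤ |P (toR (x (ν + 1)))| := by
  obtain ⟨δ, hδ, hdet⟩ := exists_le_abs_det_apply hLPF
  obtain ⟨K₁, hK₁, hP⟩ := exists_abs_le_mul_enormZ P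
  obtain ⟨K₂, hK₂, hF⟩ := exists_abs_le_mul_enormZ F
  obtain ⟨J₀, hJ⟩ := hsii
  obtain ⟨K, hK⟩ : ∃ K, K = K₁ + K₂ + 1 := ⟨_, rfl⟩
  have hK0 : 0 < K := by linarith
  have hX (n : ℕ) : 1 ≤ enormZ (x n) := one_le_enormZ (hx0 n)
  have hPK (n : ℕ) : |P (toR (x n))| ≤ K * enormZ (x n) :=
    (hP _).trans (mul_le_mul_of_nonneg_right (by linarith) (zero_le_one.trans (hX n)))
  have hFK (n : ℕ) : |F (toR (x n))| ≤ K * enormZ (x n) :=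
    (hF _).trans (mul_le_mul_of_nonneg_right (by linarith) (zero_le_one.trans (hX n)))
  have hsmall (C e : ℝ) (he : e < 0) : ∀ᶠ n in atTop, C * enormZ (x n) ^ e ≤ δ / 4 := by
    have h0 : Tendsto (fun n => C * enormZ (x n) ^ e) atTop (𝓝 0) := by
      have h := (tendsto_rpow_neg_atTop (neg_pos.mpr he)).comp (tendsto_enormZ_atTop hXlt)
      simpa [Function.comp_def] using h.const_mul C
    exact h0.eventually_le_const (by positivity)
  obtain ⟨N, hN⟩ := eventually_atTop.mp ((hsmall (3 * K ^ 2) (2 - α) (by linarith)).and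
    (hsmall (K * (δ / (6 * K ^ 2)) ^ (1 - α)) (r - (α ^ 2 - α + 1)) (by linarith)))
  refine ⟨δ / (4 * K), by positivity, max N (J₀ + 1), fun ν hν hli hPν => ?_⟩
  obtain ⟨hs₁, hs₂⟩ := hN ν ((le_max_left _ _).trans hν)
  have hJν : J₀ + 1 ≤ ν := (le_max_right _ _).trans hν
  obtain ⟨m, rfl⟩ : ∃ m, ν = m + 1 := ⟨ν - 1, by omega⟩
  rw [Nat.add_sub_cancel] at hli
  have hD := hdet ![x m, x (m + 1), x (m + 1 + 1)] (by
    convert hli using 1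
    funext i
    fin_cases i <;> rfl)
  refine lower_bound_of_det_estimate hα hδ hK0 rfl (hX _) (hXlt _).le (hLpos m)
    (hJ m (by omega)) (hJ (m + 1) (by omega)) (abs_nonneg _) (hPK _) hPν (abs_nonneg _)
    (hPK _) (le_trans (hD.trans_eq ?_) (abs_det_expansion_le hK0.le (zero_le_one.trans (hX m))
      (hXlt m).le (hXlt _).le (hLpos _).le (hLlt _).le (hLlt m).le (hPK m) (hPK _) (hFK m) (hFK _)
      (hFK _))) hs₁ hs₂
  rw [Matrix.det_fin_three]
  simp only [Matrix.of_apply, Matrix.cons_val]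
  congr 1
  ring
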